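/- Error bound for the approximate Bellman fixed point: Let X and A be finite nonempty sets and γ ∈ [0,1). For each a ∈ A let r^a ∈ ℝ^X and let P^a be a row-stochastic X×X matrix, and let M be an X×X real matrix with ℓ∞ operator norm at most 1. Suppose v* ∈ ℝ^X satisfies the Bellman optimality equation v*(x) = max_{a∈A} ( r^a(x) + γ·(P^a v*)(x) ) for all x, and v^× ∈ ℝ^X satisfies the approximate Bellman equation v^×(x) = ( M·( max_{a∈A} ( r^a + γ·P^a v^× ) ) )(x) for all x, where max_{a∈A} is the componentwise maximum over a. Then ‖v^× − v*‖∞ ≤ (1/(1−γ))·‖M v* − v*‖∞. -/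

import Mathlib

/-- The max-norm `‖v‖∞ = max_x |v x|` of a vector over a finite nonempty index set. -/
noncomputable def maxNorm {X : Type*} [Fintype X] [Nonempty X] (v : X → ℝ) : ℝ :=
  Finset.univ.sup' Finset.univ_nonempty fun x => |v x|

theorem abs_le_maxNorm {X : Type*} [Fintype X] [Nonempty X] (v : X → ℝ) (x : X) :
    |v x| ≤ maxNorm v :=
  Finset.le_sup' (fun x => |v x|) (Finset.mem_univ x)

theorem maxNorm_le_iff {X : Type*} [Fintype X] [Nonempty X] {v : X → ℝ} {c : ℝ} :
    maxNorm v ≤ c ↔ ∀ x, |v x| ≤ c := by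
  simp [maxNorm]

theorem maxNorm_nonneg {X : Type*} [Fintype X] [Nonempty X] (v : X → ℝ) : 0 ≤ maxNorm v :=
  (abs_nonneg _).trans (abs_le_maxNorm v (Classical.arbitrary X))

theorem maxNorm_add_le {X : Type*} [Fintype X] [Nonempty X] (v w : X → ℝ) :
    maxNorm (v + w) ≤ maxNorm v + maxNorm w :=
  maxNorm_le_iff.2 fun x =>
    (abs_add_le _ _).trans (add_le_add (abs_le_maxNorm v x) (abs_le_maxNorm w x))

/-- A matrix whose absolute row sums are at most one is nonexpansive for the max-norm. -/
theorem maxNorm_mulVec_le {X : Type*} [Fintype X] [Nonempty X] {M : Matrix X X ℝ}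
    (hM : ∀ x, ∑ y, |M x y| ≤ 1) (v : X → ℝ) : maxNorm (M.mulVec v) ≤ maxNorm v := by
  refine maxNorm_le_iff.2 fun x => ?_
  calc |∑ y, M x y * v y| ≤ ∑ y, |M x y * v y| := Finset.abs_sum_le_sum_abs _ _
    _ ≤ ∑ y, |M x y| * maxNorm v := by
      gcongr with y
      rw [abs_mul]
      gcongr
      exact abs_le_maxNorm v y
    _ = (∑ y, |M x y|) * maxNorm v := (Finset.sum_mul _ _ _).symm
    _ ≤ maxNorm v := mul_le_of_le_one_left (maxNorm_nonneg v) (hM x)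

theorem Finset.abs_sup'_sub_sup'_le {A : Type*} {s : Finset A} (hs : s.Nonempty) {f g : A → ℝ}
    {c : ℝ} (h : ∀ a ∈ s, |f a - g a| ≤ c) : |s.sup' hs f - s.sup' hs g| ≤ c := by
  rw [abs_sub_le_iff, sub_le_iff_le_add, sub_le_iff_le_add]
  constructor <;> refine Finset.sup'_le _ _ fun a ha => ?_
  · linarith [(abs_sub_le_iff.1 (h a ha)).1, Finset.le_sup' g ha]
  · linarith [(abs_sub_le_iff.1 (h a ha)).2, Finset.le_sup' f ha]

/-- The Bellman optimality operator. -/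
noncomputable def bellman {X A : Type*} [Fintype X] [Fintype A] [Nonempty A]
    (γ : ℝ) (r : A → X → ℝ) (P : A → Matrix X X ℝ) (v : X → ℝ) : X → ℝ := fun x =>
  Finset.univ.sup' Finset.univ_nonempty fun a => r a x + γ * (P a).mulVec v x

/-- The Bellman operator is a `γ`-contraction for the max-norm. -/
theorem maxNorm_bellman_sub_le {X A : Type*} [Fintype X] [Nonempty X] [Fintype A] [Nonempty A]
    {γ : ℝ} (hγ : 0 ≤ γ) (r : A → X → ℝ) {P : A → Matrix X X ℝ}
    (hP0 : ∀ a x y, 0 ≤ P a x y) (hP1 : ∀ a x, ∑ y, P a x y = 1) (v w : X → ℝ) :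
    maxNorm (bellman γ r P v - bellman γ r P w) ≤ γ * maxNorm (v - w) := by
  refine maxNorm_le_iff.2 fun x => Finset.abs_sup'_sub_sup'_le _ fun a _ => ?_
  have hP : ∀ x, ∑ y, |P a x y| ≤ 1 := fun x => by simp [abs_of_nonneg (hP0 a x _), hP1]
  calc |r a x + γ * (P a).mulVec v x - (r a x + γ * (P a).mulVec w x)|
      = γ * |(P a).mulVec (v - w) x| := by
        rw [add_sub_add_left_eq_sub, ← mul_sub, abs_mul, abs_of_nonneg hγ, Matrix.mulVec_sub,
          Pi.sub_apply]
    _ ≤ γ * maxNorm (v - w) := by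
        gcongr
        exact (abs_le_maxNorm _ x).trans (maxNorm_mulVec_le hP _)

/-- error bound for the approximate Bellman fixed point:
`‖v^× − v*‖∞ ≤ (1/(1−γ))·‖M v* − v*‖∞`. -/
theorem avi_fixed_point_error
    {X A : Type*} [Fintype X] [Nonempty X] [Fintype A] [Nonempty A]
    (γ : ℝ) (hγ0 : 0 ≤ γ) (hγ1 : γ < 1)
    (r : A → X → ℝ)
    (P : A → Matrix X X ℝ)
    (hP0 : ∀ a x y, 0 ≤ P a x y) (hP1 : ∀ a x, ∑ y, P a x y = 1)
    (M : Matrix X X ℝ) (hM : ∀ x, ∑ y, |M x y| ≤ 1)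
    (vstar : X → ℝ)
    (hvstar : ∀ x, vstar x =
      Finset.univ.sup' Finset.univ_nonempty fun a => r a x + γ * (P a).mulVec vstar x)
    (vtimes : X → ℝ)
    (hvtimes : ∀ x, vtimes x =
      M.mulVec (fun x' =>
        Finset.univ.sup' Finset.univ_nonempty fun a => r a x' + γ * (P a).mulVec vtimes x') x) :
    maxNorm (vtimes - vstar) ≤ (1 / (1 - γ)) * maxNorm (M.mulVec vstar - vstar) := by
  have hstar : vstar = bellman γ r P vstar := funext hvstar
  have htimes : vtimes = M.mulVec (bellman γ r P vtimes) := funext hvtimes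
  have hsplit : vtimes - vstar =
      M.mulVec (bellman γ r P vtimes - bellman γ r P vstar) + (M.mulVec vstar - vstar) := by
    rw [Matrix.mulVec_sub, ← htimes, ← hstar, sub_add_sub_cancel]
  have hle : maxNorm (vtimes - vstar) ≤
      γ * maxNorm (vtimes - vstar) + maxNorm (M.mulVec vstar - vstar) :=
    calc maxNorm (vtimes - vstar)
        ≤ maxNorm (M.mulVec (bellman γ r P vtimes - bellman γ r P vstar)) +
          maxNorm (M.mulVec vstar - vstar) := by
          conv_lhs => rw [hsplit]
          exact maxNorm_add_le _ _
      _ ≤ γ * maxNorm (vtimes - vstar) + maxNorm (M.mulVec vstar - vstar) := by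
          gcongr
          exact (maxNorm_mulVec_le hM _).trans (maxNorm_bellman_sub_le hγ0 r hP0 hP1 _ _)
  rw [one_div_mul_eq_div, le_div_iff₀ (sub_pos.2 hγ1)]
  linarith
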